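/- arXiv:1302.0454 — 2 statements merged into one kernel-verified Lean document; each statement's English description precedes it below -/
import Mathlib

section
/- Let Z be a Martin-Löf random Δ⁰₂ set. Let q : ℕ → ℚ be computable, nonincreasing, and strictly positive. If Z is a g-change set for g(n) = ⌊q(n)·2^n⌋, then there is a rational δ > 0 such that q(n) ≥ δ for all n (i.e. lim_n q(n) > 0). -/
/-! Basic definitions: Cantor space, initial segments, computable approximations,
Martin-Löf randomness, change counting, cost functions, oracle computability. -/

/-- The length-`n` initial segment of `Z : ℕ → Bool`, as a list of booleans. -/
def restr (Z : ℕ → Bool) (n : ℕ) : List Bool := (List.range n).map Z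

/-- `σ` is an initial segment of `Z`. -/
def InitSeg (σ : List Bool) (Z : ℕ → Bool) : Prop := σ = restr Z σ.length

/-- `Z` is Martin-Löf random: for every computable sequence of strings with
finite total measure, only finitely many are initial segments of `Z`. -/
def MLRandom (Z : ℕ → Bool) : Prop :=
  ∀ σ : ℕ → List Bool, Computable σ →
    Summable (fun i => ((1 : ℝ) / 2) ^ (σ i).length) →
    {i | InitSeg (σ i) Z}.Finite

/-- `(Zs s) s∈ℕ` converges pointwise to `Z`. -/
def Approx (Zs : ℕ → ℕ → Bool) (Z : ℕ → Bool) : Prop :=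
  ∀ x, ∃ t, ∀ s, t ≤ s → Zs s x = Z x

/-- `Zs` is a computable approximation of `Z`. -/
def CompApprox (Zs : ℕ → ℕ → Bool) (Z : ℕ → Bool) : Prop :=
  Computable₂ Zs ∧ Approx Zs Z

/-- `Z` is Δ⁰₂: it has a computable approximation. -/
def Delta02 (Z : ℕ → Bool) : Prop := ∃ Zs, CompApprox Zs Z

/-- The set of stages `s ≥ 1` at which the length-`n` initial segment of the
approximation changes. -/
def changeStages (Zs : ℕ → ℕ → Bool) (n : ℕ) : Set ℕ :=
  {s | 1 ≤ s ∧ restr (Zs s) n ≠ restr (Zs (s - 1)) n}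

/-- `Z` is a `g`-change set. -/
def GChangeSet (Z : ℕ → Bool) (g : ℕ → ℕ) : Prop :=
  ∃ Zs, CompApprox Zs Z ∧
    ∀ n, (changeStages Zs n).Finite ∧ (changeStages Zs n).ncard ≤ g n

/-- `Z` is ω-c.a.: a `g`-change set for some computable `g`. -/
def OmegaCA (Z : ℕ → Bool) : Prop := ∃ g : ℕ → ℕ, Computable g ∧ GChangeSet Z g

/-- Lexicographic order on Cantor space. -/
def LexLE (X Y : ℕ → Bool) : Prop :=
  X = Y ∨ ∃ n, (∀ i, i < n → X i = Y i) ∧ X n = false ∧ Y n = true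

/-- `Z` is left-c.e. -/
def LeftCE (Z : ℕ → Bool) : Prop :=
  ∃ Zs, CompApprox Zs Z ∧ ∀ s, LexLE (Zs s) (Zs (s + 1))

/-- `c` is a cost function: computable, nonnegative, nondecreasing in the stage,
nonincreasing in the number. -/
def CostFunction (c : ℕ → ℕ → ℚ) : Prop :=
  Computable₂ c ∧ (∀ x s, 0 ≤ c x s) ∧
    (∀ x s t, s ≤ t → c x s ≤ c x t) ∧ (∀ x y s, x ≤ y → c y s ≤ c x s)

/-- The limit condition for a cost function. -/
def LimitCondition (c : ℕ → ℕ → ℚ) : Prop :=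
  ∀ ε : ℚ, 0 < ε → ∃ x₀, ∀ x, x₀ ≤ x → ∀ s, c x s ≤ ε

/-- A benign cost function: the number of pairwise disjoint intervals `[x,s)` with
`c x s ≥ 2^{-k}` is computably bounded in `k`. -/
def Benign (c : ℕ → ℕ → ℚ) : Prop :=
  ∃ b : ℕ → ℕ, Computable b ∧
    ∀ k m (x s : ℕ → ℕ), (∀ i, i < m → x i < s i) →
      (∀ i, i + 1 < m → s i ≤ x (i + 1)) →
      (∀ i, i < m → ((1 : ℚ) / 2) ^ k ≤ c (x i) (s i)) → m ≤ b k

open Classical in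
/-- The cost paid at stage `s` by the approximation `As`: if `s ≥ 1` and the
approximation changes at `s`, it is `c x s` where `x` is the least changed number. -/
noncomputable def stageCost (c : ℕ → ℕ → ℚ) (As : ℕ → ℕ → Bool) (s : ℕ) : ℚ :=
  if s = 0 then 0
  else if h : ∃ x, As s x ≠ As (s - 1) x then c (Nat.find h) s else 0

/-- `A` obeys the cost function `c`: some computable approximation of `A` has
finite total cost. -/
def Obeys (A : ℕ → Bool) (c : ℕ → ℕ → ℚ) : Prop :=
  ∃ As, CompApprox As A ∧ ∃ B : ℚ, ∀ F : Finset ℕ, ∑ s ∈ F, stageCost c As s ≤ B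

/-- Functions partial recursive in the oracle `O`. -/
inductive RecIn (O : ℕ →. ℕ) : (ℕ →. ℕ) → Prop
  | oracle : RecIn O O
  | zero : RecIn O (pure 0)
  | succ : RecIn O ↑Nat.succ
  | left : RecIn O ↑fun n : ℕ => n.unpair.1
  | right : RecIn O ↑fun n : ℕ => n.unpair.2
  | pair {f g} : RecIn O f → RecIn O g → RecIn O fun n => Nat.pair <$> f n <*> g n
  | comp {f g} : RecIn O f → RecIn O g → RecIn O fun n => g n >>= f
  | prec {f g} : RecIn O f → RecIn O g → RecIn O (Nat.unpaired fun a n =>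
      n.rec (f a) fun y IH => do let i ← IH; g (Nat.pair a (Nat.pair y i)))
  | rfind {f} : RecIn O f → RecIn O fun a =>
      Nat.rfind fun n => (fun m => m = 0) <$> f (Nat.pair a n)

/-- The characteristic function of `A` as a partial function ℕ →. ℕ. -/
def charFn (A : ℕ → Bool) : ℕ →. ℕ := fun n => Part.some (cond (A n) 1 0)

/-- Turing reducibility: `A ≤_T Z`. -/
def TuringLE (A Z : ℕ → Bool) : Prop := RecIn (charFn Z) (charFn A)

/-- `A` is computably enumerable: the domain of a partial computable function. -/
def CE (A : ℕ → Bool) : Prop :=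
  ∃ f : ℕ →. ℕ, Nat.Partrec f ∧ ∀ x, A x = true ↔ (f x).Dom

/-- A Π⁰₁ class of elements of Cantor space. -/
def Pi01 (P : Set (ℕ → Bool)) : Prop :=
  ∃ f : ℕ → Option (List Bool), Computable f ∧
    P = {Z | ∀ i σ, f i = some σ → ¬ InitSeg σ Z}

/-- The c.e. set `W_e`: the domain of the `e`-th partial computable function. -/
def Wset (e : ℕ) : Set ℕ :=
  {x | ((Denumerable.ofNat Nat.Partrec.Code e).eval x).Dom}

/-- The stage-`s` approximation to `W_e`, via step-bounded evaluation. -/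
def WAt (e s x : ℕ) : Prop :=
  (Nat.Partrec.Code.evaln s (Denumerable.ofNat Nat.Partrec.Code e) x).isSome

/-- `A` is promptly simple. -/
def PromptlySimple (A : ℕ → Bool) : Prop :=
  CE A ∧ {x | A x = false}.Infinite ∧
    ∃ As : ℕ → ℕ → Bool, Computable₂ As ∧
      (∀ s x, As s x = true → As (s + 1) x = true) ∧
      (∀ x, A x = true ↔ ∃ s, As s x = true) ∧
      ∀ e, (Wset e).Infinite →
        ∃ s x, 1 ≤ s ∧ WAt e s x ∧ ¬ WAt e (s - 1) x ∧ As s x = true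

open Encodable

theorem computable_find {α : Type*} [Primcodable α] {p : α → ℕ → Bool} (hp : Computable₂ p)
    (h : ∀ a, ∃ n, p a n = true) : Computable fun a => Nat.find (h a) := by
  have := Partrec.rfind (p := fun a n => Part.some (p a n)) hp.partrec₂
  refine Partrec.of_eq this fun a => ?_
  refine Part.eq_some_iff.2 (Nat.mem_rfind.2 ⟨?_, ?_⟩)
  · simpa using (Nat.find_spec (h a)).symm
  · intro m hm
    simpa using Nat.find_min (h a) hm

/-- the old (non-surjective) code of a rational -/
def ratCode (r : ℚ) : ℕ := @encode ℚ Rat.instEncodable r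

theorem ratCode_eq (r : ℚ) : ratCode r = Nat.pair (Equiv.intEquivNat r.num) r.den := rfl

theorem natAbs_intEquivNat (z : ℤ) : z.natAbs = (Equiv.intEquivNat z + 1) / 2 := by
  cases z with
  | ofNat n =>
    have : Equiv.intEquivNat (Int.ofNat n) = 2 * n := by
      simp only [Equiv.intEquivNat, Equiv.intEquivNatSumNat]
      rfl
    rw [this]; simp; omega
  | negSucc n =>
    have : Equiv.intEquivNat (Int.negSucc n) = 2 * n + 1 := by
      simp [Equiv.intEquivNat, Equiv.intEquivNatSumNat]
    rw [this]; simp; omega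

theorem intEquivNat_pos (z : ℤ) (h : 0 < z) : (Equiv.intEquivNat z : ℤ) = 2 * z := by
  cases z with
  | ofNat n =>
    have : Equiv.intEquivNat (Int.ofNat n) = 2 * n := by
      simp only [Equiv.intEquivNat, Equiv.intEquivNatSumNat]
      rfl
    rw [this]; simp
  | negSucc n => simp at h

/-- being coprime-coded -/
def CodeOK (y : ℕ) : Prop :=
  0 < y.unpair.2 ∧ ∀ d < y.unpair.2 + 1, d ≠ 1 →
    ¬ (((y.unpair.1 + 1) / 2) % d = 0 ∧ y.unpair.2 % d = 0)

theorem cop_iff (x b : ℕ) (hb : 0 < b) :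
    (∀ d < b + 1, d ≠ 1 → ¬ (x % d = 0 ∧ b % d = 0)) ↔ Nat.Coprime x b := by
  constructor
  · intro h
    by_contra hc
    refine h (Nat.gcd x b) ?_ hc ⟨?_, ?_⟩
    · exact Nat.lt_succ_of_le (Nat.gcd_le_right _ hb)
    · exact Nat.mod_eq_zero_of_dvd (Nat.gcd_dvd_left _ _)
    · exact Nat.mod_eq_zero_of_dvd (Nat.gcd_dvd_right _ _)
  · rintro h d _ h1 ⟨h2, h3⟩
    exact h1 (Nat.eq_one_of_dvd_coprimes h (Nat.dvd_of_mod_eq_zero h2) (Nat.dvd_of_mod_eq_zero h3))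

theorem codeOK_iff (y : ℕ) : CodeOK y ↔ y ∈ Set.range ratCode := by
  unfold CodeOK
  constructor
  · rintro ⟨h0, h⟩
    rw [cop_iff _ _ h0] at h
    refine ⟨⟨Equiv.intEquivNat.symm y.unpair.1, y.unpair.2, h0.ne', ?_⟩, ?_⟩
    · rw [natAbs_intEquivNat]; simpa using h
    · rw [ratCode_eq]; simp
  · rintro ⟨r, rfl⟩
    rw [ratCode_eq]
    have h0 : 0 < (Nat.pair (Equiv.intEquivNat r.num) r.den).unpair.2 := by
      simpa using r.den_pos
    refine ⟨h0, ?_⟩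
    rw [cop_iff _ _ h0]
    simp only [Nat.unpair_pair]
    rw [← natAbs_intEquivNat]
    exact r.reduced

theorem codeOK_primrec : PrimrecPred CodeOK := by
  have hu1 : Primrec fun y : ℕ => y.unpair.1 := Primrec.fst.comp Primrec.unpair
  have hu2 : Primrec fun y : ℕ => y.unpair.2 := Primrec.snd.comp Primrec.unpair
  have hR : PrimrecRel fun d y : ℕ => d ≠ 1 →
    ¬ (((y.unpair.1 + 1) / 2) % d = 0 ∧ y.unpair.2 % d = 0) := by
    have hx : Primrec fun p : ℕ × ℕ => ((p.2.unpair.1 + 1) / 2) % p.1 :=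
      Primrec.nat_mod.comp (Primrec.nat_div.comp
        (Primrec.succ.comp (hu1.comp Primrec.snd)) (Primrec.const 2)) Primrec.fst
    have hb : Primrec fun p : ℕ × ℕ => p.2.unpair.2 % p.1 :=
      Primrec.nat_mod.comp (hu2.comp Primrec.snd) Primrec.fst
    have h1 : PrimrecPred fun p : ℕ × ℕ => p.1 = 1 :=
      Primrec.eq.comp Primrec.fst (Primrec.const 1)
    have h2 := Primrec.eq.comp hx (Primrec.const 0)
    have h3 := Primrec.eq.comp hb (Primrec.const 0)
    refine (h1.or (h2.and h3).not).of_eq ?_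
    intro p
    by_cases h : p.1 = 1 <;> simp [h]
  have h1 : PrimrecPred fun y : ℕ => 0 < y.unpair.2 :=
    Primrec.nat_lt.comp (Primrec.const 0) hu2
  have h2 := hR.forall_lt.comp (Primrec.succ.comp hu2) Primrec.id
  exact (h1.and h2).of_eq fun y => Iff.rfl

theorem exists_codeOK (x : ℕ) : ∃ m, x + m + 1 ∈ Set.range ratCode := by
  refine ⟨(ratCode ⟨1, x+1, by simp, by simp⟩) - (x + 1),
    ⟨⟨1, x+1, by simp, by simp⟩, ?_⟩⟩
  have : x + 1 ≤ ratCode ⟨1, x+1, by simp, by simp⟩ := by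
    rw [ratCode_eq]
    exact Nat.right_le_pair _ _
  omega

theorem ratCode_ofNat_computable : Computable fun m => ratCode (Denumerable.ofNat ℚ m) := by
  classical
  let S : Set ℕ := Set.range (@encode ℚ Rat.instEncodable)
  let iD : DecidablePred (· ∈ S) := @decidableRangeEncode ℚ _
  have iI : Infinite S := Infinite.of_injective _ (Equiv.ofInjective _ encode_injective).injective
  have key : ∀ m, ratCode (Denumerable.ofNat ℚ m) = (Nat.Subtype.ofNat S m : ℕ) := by
    intro m
    have h : Denumerable.ofNat ℚ m = (@equivRangeEncode ℚ Rat.instEncodable).symm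
      (Nat.Subtype.ofNat S m) := by
      rw [Denumerable.ofNat_of_decode]
      rfl
    rw [h]
    have h2 := (@equivRangeEncode ℚ Rat.instEncodable).apply_symm_apply (Nat.Subtype.ofNat S m)
    exact congrArg Subtype.val h2
  have hE : Computable fun y : ℕ => decide (CodeOK y) := codeOK_primrec.decide.to_comp
  have hp : Computable₂ fun x m : ℕ => decide (CodeOK (x + m + 1)) :=
    hE.comp (Primrec.succ.comp (Primrec.nat_add.comp Primrec.fst Primrec.snd)).to_comp
  have hex : ∀ x, ∃ m, decide (CodeOK (x + m + 1)) = true := by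
    intro x
    obtain ⟨m, hm⟩ := exists_codeOK x
    exact ⟨m, by simpa using (codeOK_iff _).2 hm⟩
  have hf := computable_find hp hex
  have hstep : Computable fun x => x + Nat.find (hex x) + 1 :=
    Computable.succ.comp (Primrec.nat_add.to_comp.comp Computable.id hf)
  have hrec := Computable.nat_rec (f := fun m : ℕ => m)
    (g := fun _ => ((Nat.Subtype.ofNat S 0 : S) : ℕ))
    (h := fun _ p => p.2 + Nat.find (hex p.2) + 1) Computable.id (Computable.const _)
    (hstep.comp (Computable.snd.comp Computable.snd)).to₂
  refine hrec.of_eq fun m => ?_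
  rw [key]
  induction m with
  | zero => rfl
  | succ m ih =>
    simp only at ih ⊢
    rw [ih]
    change _ = ((Nat.Subtype.succ (Nat.Subtype.ofNat S m) : S) : ℕ)
    unfold Nat.Subtype.succ
    simp only
    congr 2
    apply Nat.find_congr'
    intro n
    simp only [decide_eq_true_eq]
    exact codeOK_iff _

theorem ratCode_computable : Computable ratCode :=
  (ratCode_ofNat_computable.comp Computable.encode).of_eq fun r => by
    rw [Denumerable.ofNat_encode]

theorem restr_succ (Z : ℕ → Bool) (n : ℕ) : restr Z (n + 1) = restr Z n ++ [Z n] := by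
  simp [restr, List.range_succ]

theorem restr_length (Z : ℕ → Bool) (n : ℕ) : (restr Z n).length = n := by simp [restr]

theorem restr_computable {α : Type*} [Primcodable α] {F : α → ℕ → Bool} (hF : Computable₂ F)
    {n : α → ℕ} (hn : Computable n) : Computable fun a => restr (F a) (n a) := by
  have := Computable.nat_rec (f := n) (g := fun _ => ([] : List Bool))
    (h := fun a p => p.2 ++ [F a p.1]) hn (Computable.const _)
    (Computable.list_concat.comp (Computable.snd.comp Computable.snd)
      (hF.comp Computable.fst (Computable.fst.comp Computable.snd))).to₂
  refine this.of_eq fun a => ?_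
  induction n a with
  | zero => rfl
  | succ m ih => simp only at ih ⊢; rw [ih, restr_succ]

theorem pow_computable : Computable fun k : ℕ => 2 ^ k := by
  have := Computable.nat_rec (f := fun k : ℕ => k) (g := fun _ => 1)
    (h := fun _ p => p.2 * 2) Computable.id (Computable.const _)
    (Primrec.nat_mul.comp (Primrec.snd.comp Primrec.snd) (Primrec.const 2)).to_comp.to₂
  refine this.of_eq fun k => ?_
  induction k with
  | zero => rfl
  | succ m ih => simp only at ih ⊢; rw [ih, pow_succ]

theorem le_iff_code (r : ℚ) (hr : 0 < r) (k : ℕ) :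
    r ≤ (1 / 2) ^ k ↔ (ratCode r).unpair.1 * 2 ^ k ≤ 2 * (ratCode r).unpair.2 := by
  rw [ratCode_eq]
  simp only [Nat.unpair_pair]
  have h := intEquivNat_pos r.num (Rat.num_pos.2 hr)
  have hd : (0 : ℚ) < r.den := by exact_mod_cast r.den_pos
  have hq : ((Equiv.intEquivNat r.num : ℕ) : ℚ) = 2 * r.num := by exact_mod_cast h
  rw [← Nat.cast_le (α := ℚ)]
  push_cast
  rw [hq]
  have e : r = r.num / r.den := (Rat.num_div_den r).symm
  have : r ≤ (1 / 2) ^ k ↔ (r.num : ℚ) / r.den ≤ (1/2)^k := by rw [← e]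
  rw [this, div_le_iff₀ hd, div_pow, one_pow, div_mul_eq_mul_div, one_mul, le_div_iff₀ (by positivity)]
  constructor <;> intro h <;> linarith

theorem exists_levels (q : ℕ → ℚ) (hq : Computable q) (hmono : ∀ m n, m ≤ n → q n ≤ q m)
    (hpos : ∀ n, 0 < q n) (hneg : ¬ ∃ δ : ℚ, 0 < δ ∧ ∀ n, δ ≤ q n) :
    ∃ N : ℕ → ℕ, Computable N ∧ ∀ k, k ≤ N k ∧ q (N k) ≤ (1 / 2) ^ k := by
  have hc : Computable fun p : ℕ × ℕ => ratCode (q (p.1 + p.2)) :=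
    ratCode_computable.comp (hq.comp Primrec.nat_add.to_comp)
  have hp : Computable₂ fun k m : ℕ => decide ((ratCode (q (k + m))).unpair.1 * 2 ^ k ≤
      2 * (ratCode (q (k + m))).unpair.2) := by
    have hu := Computable.unpair.comp hc
    exact Primrec.nat_le.decide.to_comp.comp
      (Primrec.nat_mul.to_comp.comp (Computable.fst.comp hu) (pow_computable.comp Computable.fst))
      (Primrec.nat_mul.to_comp.comp (Computable.const 2) (Computable.snd.comp hu))
  have hex : ∀ k, ∃ m, decide ((ratCode (q (k + m))).unpair.1 * 2 ^ k ≤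
      2 * (ratCode (q (k + m))).unpair.2) = true := by
    intro k
    simp only [decide_eq_true_eq, ← le_iff_code _ (hpos _)]
    push Not at hneg
    obtain ⟨n, hn⟩ := hneg ((1/2)^k) (by positivity)
    exact ⟨n, (hmono _ _ (by omega)).trans hn.le⟩
  refine ⟨fun k => k + Nat.find (hex k),
    Primrec.nat_add.to_comp.comp Computable.id (computable_find hp hex), fun k => ⟨by simp, ?_⟩⟩
  rw [le_iff_code _ (hpos _)]
  simpa using Nat.find_spec (hex k)

/-- stage counts as a new string -/
def isNew (Zs : ℕ → ℕ → Bool) (n s : ℕ) : Bool :=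
  decide (s = 0) || !decide (restr (Zs s) n = restr (Zs (s - 1)) n)

theorem isNew_iff (Zs : ℕ → ℕ → Bool) (n s : ℕ) :
    isNew Zs n s = true ↔ s ∈ insert 0 (changeStages Zs n) := by
  simp only [isNew, changeStages, Set.mem_insert_iff, Set.mem_ofPred_eq, Bool.or_eq_true,
    decide_eq_true_eq, Bool.not_eq_true', decide_eq_false_iff_not]
  by_cases h : s = 0
  · simp [h]
  · simp [h, Nat.one_le_iff_ne_zero]

/-- the test -/
def testSeq (Zs : ℕ → ℕ → Bool) (N : ℕ → ℕ) (i : ℕ) : List Bool :=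
  bif isNew Zs (N i.unpair.1) i.unpair.2 then restr (Zs i.unpair.2) (N i.unpair.1)
  else restr (fun _ => false) i

theorem testSeq_computable {Zs : ℕ → ℕ → Bool} (hZ : Computable₂ Zs) {N : ℕ → ℕ}
    (hN : Computable N) : Computable (testSeq Zs N) := by
  have hk : Computable fun i : ℕ => N i.unpair.1 := hN.comp (Computable.fst.comp Computable.unpair)
  have hs : Computable fun i : ℕ => i.unpair.2 := Computable.snd.comp Computable.unpair
  have hs' : Computable fun i : ℕ => i.unpair.2 - 1 := Computable.pred.comp hs
  have h1 : Computable fun i : ℕ => restr (Zs i.unpair.2) (N i.unpair.1) :=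
    restr_computable (F := fun i => Zs i.unpair.2)
      (hZ.comp (hs.comp Computable.fst) Computable.snd) hk
  have h2 : Computable fun i : ℕ => restr (Zs (i.unpair.2 - 1)) (N i.unpair.1) :=
    restr_computable (F := fun i => Zs (i.unpair.2 - 1))
      (hZ.comp (hs'.comp Computable.fst) Computable.snd) hk
  have h3 : Computable fun i : ℕ => restr (fun _ => false) i :=
    restr_computable (F := fun _ _ => false) (Computable.const false).to₂ Computable.id
  have h4 : Computable fun i : ℕ => decide (i.unpair.2 = 0) :=
    Primrec.eq.decide.to_comp.comp hs (Computable.const 0)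
  have h5 : Computable fun i : ℕ => !decide (restr (Zs i.unpair.2) (N i.unpair.1)
      = restr (Zs (i.unpair.2 - 1)) (N i.unpair.1)) :=
    Primrec.not.to_comp.comp (Primrec.eq.decide.to_comp.comp h1 h2)
  exact Computable.cond (Primrec.or.to_comp.comp h4 h5) h1 h3

theorem row_arith (c k n : ℕ) (r : ℚ) (hr : 0 < r) (hkn : k ≤ n) (hrk : r ≤ (1 / 2) ^ k)
    (hcard : c ≤ ⌊r * 2 ^ n⌋₊ + 1) : (c : ℝ) * (1 / 2) ^ n ≤ 2 * (1 / 2) ^ k := by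
  have hq2 : ((⌊r * 2 ^ n⌋₊ : ℕ) : ℚ) ≤ (1/2)^k * 2 ^ n :=
    (Nat.floor_le (mul_nonneg hr.le (by positivity))).trans
      (mul_le_mul_of_nonneg_right hrk (by positivity))
  generalize ⌊r * 2 ^ n⌋₊ = f at hq2 hcard
  have hr2 : (f : ℝ) ≤ (1/2)^k * 2 ^ n := by
    have := (Rat.cast_le (K := ℝ)).2 hq2
    push_cast at this
    exact this
  have hc' : (c : ℝ) ≤ f + 1 := by
    exact_mod_cast hcard
  have hp : ((1:ℝ)/2)^n ≤ (1/2)^k := pow_le_pow_of_le_one (by norm_num) (by norm_num) hkn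
  have hm : (2:ℝ)^n * (1/2)^n = 1 := by rw [← mul_pow]; norm_num
  calc (c : ℝ) * (1/2)^n
      ≤ ((1/2)^k * 2 ^ n + 1) * (1/2)^n :=
        mul_le_mul_of_nonneg_right (hc'.trans (by linarith)) (by positivity)
    _ = (1/2)^k * (2 ^ n * (1/2)^n) + (1/2)^n := by ring
    _ ≤ 2 * (1/2)^k := by rw [hm]; linarith

theorem testSeq_summable {Zs : ℕ → ℕ → Bool} {N : ℕ → ℕ} {q : ℕ → ℚ} (hpos : ∀ n, 0 < q n)
    (hN : ∀ k, k ≤ N k ∧ q (N k) ≤ (1 / 2) ^ k)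
    (hch : ∀ n, (changeStages Zs n).Finite ∧ (changeStages Zs n).ncard ≤ ⌊q n * 2 ^ n⌋₊) :
    Summable (fun i => ((1 : ℝ) / 2) ^ (testSeq Zs N i).length) := by
  obtain ⟨u, hu_def⟩ : ∃ u : ℕ × ℕ → ℝ,
      ∀ p, u p = if isNew Zs (N p.1) p.2 then (1 / 2) ^ (N p.1) else 0 := ⟨_, fun _ => rfl⟩
  have hu0 : ∀ p, 0 ≤ u p := fun p => by
    rw [hu_def]; split_ifs <;> positivity
  have hfin : ∀ k, (insert 0 (changeStages Zs (N k))).Finite := fun k => (hch _).1.insert 0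
  have hsup : ∀ k s, s ∉ (hfin k).toFinset → u (k, s) = 0 := by
    intro k s hs
    simp only [Set.Finite.mem_toFinset, ← isNew_iff] at hs
    simp [hu_def, hs]
  have hu : Summable u := by
    rw [summable_prod_of_nonneg (fun p => hu0 p)]
    refine ⟨fun k => summable_of_ne_finset_zero (s := (hfin k).toFinset) fun s hs => hsup k s hs, ?_⟩
    refine Summable.of_nonneg_of_le (fun k => tsum_nonneg fun s => hu0 _) (fun k => ?_)
      ((summable_geometric_two).mul_left 2)
    rw [tsum_eq_sum (s := (hfin k).toFinset) fun s hs => hsup k s hs]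
    have h1 : ∑ s ∈ (hfin k).toFinset, u (k, s) ≤ ∑ s ∈ (hfin k).toFinset, ((1:ℝ) / 2) ^ (N k) := by
      refine Finset.sum_le_sum fun s _ => ?_
      rw [hu_def]; split_ifs
      · exact le_rfl
      · positivity
    refine h1.trans ?_
    rw [Finset.sum_const, nsmul_eq_mul]
    have hcard : (hfin k).toFinset.card ≤ ⌊q (N k) * 2 ^ (N k)⌋₊ + 1 := by
      rw [← Set.ncard_eq_toFinset_card _ (hfin k)]
      exact (Set.ncard_insert_le _ _).trans (Nat.add_le_add_right (hch _).2 1)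
    exact row_arith _ _ _ _ (hpos _) (hN k).1 (hN k).2 hcard
  have hu' : Summable fun i : ℕ => u i.unpair := (Equiv.summable_iff Nat.pairEquiv.symm).2 hu
  refine Summable.of_nonneg_of_le (fun i => by positivity) (fun i => ?_)
    (hu'.add summable_geometric_two)
  simp only [testSeq, hu_def]
  cases isNew Zs (N i.unpair.1) i.unpair.2
  · simp [restr_length]
  · simp [restr_length]

/-- If a ML-random Δ⁰₂ set is a `⌊q(n)·2^n⌋`-change set for a computable
nonincreasing positive rational `q`, then `q` is bounded away from `0`. -/
theorem random_change_lower_bound (Z : ℕ → Bool) (hrand : MLRandom Z) (hZ : Delta02 Z)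
    (q : ℕ → ℚ) (hq : Computable q) (hmono : ∀ m n, m ≤ n → q n ≤ q m)
    (hpos : ∀ n, 0 < q n)
    (hchange : GChangeSet Z (fun n => ⌊q n * 2 ^ n⌋₊)) :
    ∃ δ : ℚ, 0 < δ ∧ ∀ n, δ ≤ q n := by
  by_contra hneg
  obtain ⟨N, hNc, hN⟩ := exists_levels q hq hmono hpos hneg
  obtain ⟨Zs, ⟨hZc, hZa⟩, hch⟩ := hchange
  have hfin := hrand (testSeq Zs N) (testSeq_computable hZc hNc) (testSeq_summable hpos hN hch)
  have hconv : ∀ n, ∃ s, restr (Zs s) n = restr Z n := by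
    intro n
    have : ∃ t, ∀ s, t ≤ s → restr (Zs s) n = restr Z n := by
      induction n with
      | zero => exact ⟨0, fun s _ => rfl⟩
      | succ n ih =>
        obtain ⟨t, ht⟩ := ih
        obtain ⟨t', ht'⟩ := hZa n
        refine ⟨max t t', fun s hs => ?_⟩
        rw [restr_succ, restr_succ, ht s (by omega), ht' s (by omega)]
    obtain ⟨t, ht⟩ := this
    exact ⟨t, ht t le_rfl⟩
  refine Set.infinite_of_injective_forall_mem
    (f := fun k => Nat.pair k (Nat.find (hconv (N k)))) ?_ (fun k => ?_) hfin
  · intro a b hab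
    exact (Nat.pair_eq_pair.1 hab).1
  · have hs := Nat.find_spec (hconv (N k))
    have hmin := fun m => Nat.find_min (hconv (N k)) (m := m)
    set s := Nat.find (hconv (N k))
    have hnew : isNew Zs (N k) s = true := by
      rw [isNew_iff]
      by_cases h0 : s = 0
      · exact Or.inl h0
      · refine Or.inr ⟨Nat.one_le_iff_ne_zero.2 h0, fun he => ?_⟩
        exact hmin (s - 1) (by omega) (he.symm.trans hs)
    simp only [Set.mem_ofPred_eq, InitSeg, testSeq, Nat.unpair_pair, hnew, cond_true]
    rw [restr_length, hs]
end

section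
/- Suppose a cost function c satisfies the limit condition. Then there is a promptly simple set A that obeys c. -/
namespace PSaux
open Encodable

/-- The primary (non-surjective) encoding of the rationals. -/
def e0 (q : ℚ) : ℕ := @encode ℚ Rat.instEncodable q

theorem e0_eq (q : ℚ) : e0 q = Nat.pair (encode q.num) q.den := rfl

theorem encode_int (a : ℤ) : encode a = Equiv.intEquivNat a := rfl

theorem ei (a : ℤ) : (encode a + 1) / 2 = a.natAbs := by
  rw [encode_int]
  rcases a with n | n
  · have : Equiv.intEquivNat (Int.ofNat n) = 2 * n := rfl
    rw [this]; simp; omega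
  · have : Equiv.intEquivNat (Int.negSucc n) = 2 * n + 1 := rfl
    rw [this]; simp; omega

theorem e0_inj : Function.Injective e0 := @encode_injective ℚ Rat.instEncodable

theorem e0_inf : (Set.range e0).Infinite := Set.infinite_range_of_injective e0_inj

theorem sub_ofNat (s : Set ℕ) [DecidablePred (· ∈ s)] [Infinite s] (n : ℕ) :
    @Denumerable.ofNat s (Nat.Subtype.denumerable s) n = Nat.Subtype.ofNat s n := rfl

theorem e0_ofNat (n : ℕ) :
    e0 (Denumerable.ofNat ℚ n) = Nat.nth (fun x => x ∈ Set.range e0) n := by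
  have key := Nat.nth_eq_orderIsoOfNat (p := fun x => x ∈ Set.range e0) e0_inf
  refine Eq.trans ?_ (congrFun key n).symm
  have hi : Infinite (Set.range (@encode ℚ Rat.instEncodable)) := e0_inf.to_subtype
  let dP := @Encodable.decidableRangeEncode ℚ Rat.instEncodable
  have h := Nat.Subtype.orderIsoOfNat_apply (s := Set.range (@encode ℚ Rat.instEncodable))
    (n := n) (dP := dP)
  refine Eq.trans ?_ (congrArg Subtype.val h).symm
  have h1 := @Denumerable.ofEquiv_ofNat (Set.range (@encode ℚ Rat.instEncodable)) ℚ
    (Nat.Subtype.denumerable _) (@equivRangeEncode ℚ Rat.instEncodable) n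
  rw [sub_ofNat] at h1
  have h2 : Denumerable.ofNat ℚ n = (@equivRangeEncode ℚ Rat.instEncodable).symm
    (Nat.Subtype.ofNat (Set.range (@encode ℚ Rat.instEncodable)) n) := h1
  rw [h2]
  exact congrArg Subtype.val ((@equivRangeEncode ℚ Rat.instEncodable).apply_symm_apply _)

/-- Bounded search. -/
def bex (f : ℕ → Bool) (n : ℕ) : Bool := Nat.rec false (fun i b => b || f i) n

theorem bex_iff (f : ℕ → Bool) (n : ℕ) : bex f n = true ↔ ∃ i < n, f i = true := by
  induction n with
  | zero => simp [bex]
  | succ n ih =>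
    have : bex f (n + 1) = (bex f n || f n) := rfl
    rw [this, Bool.or_eq_true, ih]
    constructor
    · rintro (⟨i, hi, h⟩ | h)
      · exact ⟨i, by omega, h⟩
      · exact ⟨n, by omega, h⟩
    · rintro ⟨i, hi, h⟩
      rcases Nat.lt_succ_iff_lt_or_eq.1 hi with h' | rfl
      · exact Or.inl ⟨i, h', h⟩
      · exact Or.inr h

theorem comp_bex {α : Type*} [Primcodable α] {f : α → ℕ → Bool} {b : α → ℕ}
    (hf : Computable₂ f) (hb : Computable b) : Computable fun a => bex (f a) (b a) := by
  have : Computable₂ fun (a : α) (p : ℕ × Bool) => (p.2 || f a p.1) :=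
    Primrec.or.to_comp.comp (Computable.snd.comp Computable.snd)
      (hf.comp Computable.fst (Computable.fst.comp Computable.snd))
  exact Computable.nat_rec hb (Computable.const false) this

/-- Characteristic function of the range of `e0`. -/
def rb (k : ℕ) : Bool :=
  decide (0 < k.unpair.2) &&
    !(bex (fun x => !(decide (x = 1)) && (decide ((k.unpair.1 + 1) / 2 % x = 0) &&
      decide (k.unpair.2 % x = 0))) (k.unpair.2 + 1))

theorem rb_iff (k : ℕ) : rb k = true ↔ k ∈ Set.range e0 := by
  obtain ⟨⟨a, d⟩, rfl⟩ : ∃ p : ℕ × ℕ, k = Nat.pair p.1 p.2 := ⟨k.unpair, by simp⟩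
  have h1 : rb (Nat.pair a d) = true ↔ 0 < d ∧ ((a + 1) / 2).Coprime d := by
    unfold rb
    rw [Bool.and_eq_true, Bool.not_eq_true', ← Bool.not_eq_true, bex_iff]
    simp only [Nat.unpair_pair, decide_eq_true_eq, Bool.and_eq_true, Bool.not_eq_true',
      decide_eq_false_iff_not]
    refine and_congr_right fun hd => ?_
    constructor
    · intro h
      by_contra hc
      refine h ⟨((a + 1) / 2).gcd d, ?_, hc, ?_, ?_⟩
      · have := Nat.gcd_le_right ((a + 1) / 2) hd
        omega
      · exact Nat.mod_eq_zero_of_dvd (Nat.gcd_dvd_left _ _)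
      · exact Nat.mod_eq_zero_of_dvd (Nat.gcd_dvd_right _ _)
    · rintro h ⟨x, _, hx, h1, h2⟩
      exact hx (Nat.eq_one_of_dvd_coprimes h (Nat.dvd_of_mod_eq_zero h1)
        (Nat.dvd_of_mod_eq_zero h2))
  refine h1.trans ?_
  constructor
  · rintro ⟨hd, hc⟩
    have ha : encode (Equiv.intEquivNat.symm a) = a := by
      rw [encode_int]; simp
    refine ⟨⟨Equiv.intEquivNat.symm a, d, by omega, ?_⟩, ?_⟩
    · rw [← ei, ha]; exact hc
    · rw [e0_eq]
      exact congrArg (fun z => Nat.pair z d) ha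
  · rintro ⟨q, hq⟩
    rw [e0_eq, Nat.pair_eq_pair] at hq
    obtain ⟨rfl, rfl⟩ := hq
    rw [ei]
    exact ⟨q.den_pos, q.reduced⟩

theorem comp_rb : Computable rb := by
  have hd : Computable fun k : ℕ => k.unpair.2 :=
    Computable.snd.comp Computable.unpair
  have hn : Computable fun k : ℕ => (k.unpair.1 + 1) / 2 :=
    Primrec.nat_div.to_comp.comp (Computable.succ.comp (Computable.fst.comp Computable.unpair))
      (Computable.const 2)
  have heq : Computable₂ fun a b : ℕ => decide (a = b) := (Primrec.eq (α := ℕ)).decide.to_comp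
  have hlt : Computable₂ fun a b : ℕ => decide (a < b) := Primrec.nat_lt.decide.to_comp
  have hin : Computable₂ fun (k x : ℕ) => (!(decide (x = 1)) &&
      (decide ((k.unpair.1 + 1) / 2 % x = 0) && decide (k.unpair.2 % x = 0))) := by
    refine Primrec.and.to_comp.comp (Primrec.not.to_comp.comp
      (heq.comp Computable.snd (Computable.const 1)))
      (Primrec.and.to_comp.comp (heq.comp ?_ (Computable.const 0))
        (heq.comp ?_ (Computable.const 0)))
    · exact Primrec.nat_mod.to_comp.comp (hn.comp Computable.fst) Computable.snd
    · exact Primrec.nat_mod.to_comp.comp (hd.comp Computable.fst) Computable.snd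
  exact Primrec.and.to_comp.comp (hlt.comp (Computable.const 0) hd)
    (Primrec.not.to_comp.comp (comp_bex hin (Computable.succ.comp hd)))

/-- Counting elements of the range of `e0`. -/
def cnt (n : ℕ) : ℕ := Nat.rec 0 (fun i v => v + bif rb i then 1 else 0) n

theorem cnt_eq (n : ℕ) : cnt n = Nat.count (fun k => rb k = true) n := by
  induction n with
  | zero => simp [cnt]
  | succ n ih =>
    have : cnt (n + 1) = cnt n + bif rb n then 1 else 0 := rfl
    rw [this, Nat.count_succ, ih]
    cases rb n <;> simp

theorem comp_cnt : Computable cnt := by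
  have : Computable₂ fun (_ : ℕ) (p : ℕ × ℕ) => (p.2 + bif rb p.1 then 1 else 0) :=
    Primrec.nat_add.to_comp.comp (Computable.snd.comp Computable.snd)
      (Computable.cond (comp_rb.comp (Computable.fst.comp Computable.snd))
        (Computable.const 1) (Computable.const 0))
  exact Computable.nat_rec Computable.id (Computable.const 0) this

/-- The encoding of rationals underlying `Computable`. -/
def en1 (q : ℚ) : ℕ := @encode ℚ (Primcodable.toEncodable) q

theorem ofNat_en1 (q : ℚ) : Denumerable.ofNat ℚ (en1 q) = q :=
  @Denumerable.ofNat_encode ℚ Rat.instDenumerable q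

theorem comp_en1 : Computable en1 := Computable.encode

/-- A total Boolean function as a partial one. -/
def pf (f : ℕ → Bool) : ℕ →. Bool := (f : ℕ →. Bool)

theorem e0_rfind (q : ℚ) :
    Nat.rfind (pf fun k => (rb k && decide (cnt k = en1 q))) = Part.some (e0 q) := by
  have hp : (fun x => x ∈ Set.range e0) = fun k => rb k = true := by
    funext k; exact propext (rb_iff k).symm
  have h0 : e0 q = Nat.nth (fun k => rb k = true) (en1 q) := by
    rw [← hp, ← e0_ofNat, ofNat_en1]
  have hr : rb (e0 q) = true := (rb_iff _).2 ⟨q, rfl⟩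
  have hinf : (Set.ofPred fun k => rb k = true).Infinite := by
    rw [← hp]; exact e0_inf
  have hcnt : cnt (e0 q) = en1 q := by
    rw [cnt_eq, h0]
    exact Nat.count_nth fun hf => absurd hf hinf
  rw [Part.eq_some_iff, Nat.mem_rfind]
  refine ⟨by simp [pf, hr, hcnt], ?_⟩
  intro m hm
  simp only [pf, PFun.coe_val, Part.mem_some_iff]
  by_contra hc
  have hc' : rb m = true ∧ cnt m = en1 q := by
    have := eq_true_of_ne_false (fun h => hc h.symm)
    simpa using this
  have : m = e0 q := by
    refine Nat.count_injective (p := fun k => rb k = true) hc'.1 hr ?_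
    rw [← cnt_eq, ← cnt_eq, hc'.2, hcnt]
  omega

theorem comp_e0 : Computable e0 := by
  have heq : Computable₂ fun a b : ℕ => decide (a = b) := (Primrec.eq (α := ℕ)).decide.to_comp
  have h : Computable₂ fun (q : ℚ) (k : ℕ) => (rb k && decide (cnt k = en1 q)) :=
    Primrec.and.to_comp.comp (comp_rb.comp Computable.snd)
      (heq.comp (comp_cnt.comp Computable.snd) (comp_en1.comp Computable.fst))
  have h2 : Partrec fun q : ℚ =>
      Nat.rfind (pf fun k => (rb k && decide (cnt k = en1 q))) :=
    Partrec.rfind h.partrec₂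
  exact h2.of_eq e0_rfind

/-- Decides `|q| ≤ 2^{-e}`. -/
def cle (q : ℚ) (e : ℕ) : Bool :=
  decide (((e0 q).unpair.1 + 1) / 2 * 2 ^ e ≤ (e0 q).unpair.2)

theorem cle_iff (q : ℚ) (e : ℕ) (hq : 0 ≤ q) : cle q e = true ↔ q ≤ (1 / 2) ^ e := by
  unfold cle
  rw [decide_eq_true_eq, e0_eq, Nat.unpair_pair]
  simp only
  rw [ei]
  have hnum : ((q.num.natAbs : ℕ) : ℚ) = q.num := by
    have : ((q.num.natAbs : ℕ) : ℤ) = q.num := Int.natAbs_of_nonneg (Rat.num_nonneg.2 hq)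
    rw [← Int.cast_natCast, this]
  have hden : (0 : ℚ) < q.den := by exact_mod_cast q.den_pos
  have hpow : (0 : ℚ) < 2 ^ e := by positivity
  rw [← Nat.cast_le (α := ℚ)]
  push_cast
  rw [hnum, one_div, inv_pow, ← one_div, le_div_iff₀ hpow]
  have hqd : (q.num : ℚ) = q * q.den := (Rat.mul_den_eq_num q).symm
  rw [hqd]
  constructor
  · intro h
    have h' : (q * 2 ^ e) * q.den ≤ 1 * q.den := by linarith
    exact le_of_mul_le_mul_right h' hden
  · intro h
    have := mul_le_mul_of_nonneg_right h hden.le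
    linarith

theorem comp_pow : Computable fun e : ℕ => 2 ^ e := by
  have h : Computable₂ fun (_ : ℕ) (p : ℕ × ℕ) => p.2 * 2 :=
    Primrec.nat_mul.to_comp.comp (Computable.snd.comp Computable.snd) (Computable.const 2)
  refine (Computable.nat_rec Computable.id (Computable.const 1) h).of_eq fun n => ?_
  induction n with
  | zero => rfl
  | succ n ih => rw [pow_succ, ← ih]; rfl

theorem comp_cle : Computable₂ cle := by
  have hle : Computable₂ fun a b : ℕ => decide (a ≤ b) := Primrec.nat_le.decide.to_comp
  have hu : Computable fun p : ℚ × ℕ => (e0 p.1).unpair :=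
    Computable.unpair.comp (comp_e0.comp Computable.fst)
  refine hle.comp (Primrec.nat_mul.to_comp.comp (Primrec.nat_div.to_comp.comp
    (Computable.succ.comp (Computable.fst.comp hu)) (Computable.const 2))
    (comp_pow.comp Computable.snd)) (Computable.snd.comp hu)

/-- Boolean version of `WAt`. -/
def wb (e s x : ℕ) : Bool :=
  (Nat.Partrec.Code.evaln s (Denumerable.ofNat Nat.Partrec.Code e) x).isSome

theorem comp_wb {α : Type*} [Primcodable α] {f g h : α → ℕ} (hf : Computable f)
    (hg : Computable g) (hh : Computable h) : Computable fun a => wb (f a) (g a) (h a) := by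
  have h1 : Computable fun a => ((g a, Denumerable.ofNat Nat.Partrec.Code (f a)), h a) :=
    ((hg.pair ((Computable.ofNat _).comp hf)).pair hh)
  exact Primrec.option_isSome.to_comp.comp (Nat.Partrec.Code.primrec_evaln.to_comp.comp h1)

/-- `p = (t,x)` is a candidate for the `e`-th requirement. -/
def cand (c : ℕ → ℕ → ℚ) (e p : ℕ) : Bool :=
  decide (2 * e ≤ p.unpair.2) && (wb e p.unpair.1 p.unpair.2 &&
    (!(wb e (p.unpair.1 - 1) p.unpair.2) && cle (c p.unpair.2 p.unpair.1) e))

/-- The first candidate. -/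
def fst (c : ℕ → ℕ → ℚ) (e p : ℕ) : Bool := cand c e p && !(bex (cand c e) p)

/-- The enumeration. -/
def en (c : ℕ → ℕ → ℚ) (s x : ℕ) : Bool :=
  bex (fun e => bex (fun t => fst c e (Nat.pair t x)) (s + 1)) (x + 1)

theorem comp_cand {c : ℕ → ℕ → ℚ} (hc : Computable₂ c) : Computable₂ (cand c) := by
  have hle : Computable₂ fun a b : ℕ => decide (a ≤ b) := Primrec.nat_le.decide.to_comp
  have ht : Computable fun a : ℕ × ℕ => a.2.unpair.1 :=
    Computable.fst.comp (Computable.unpair.comp Computable.snd)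
  have hx : Computable fun a : ℕ × ℕ => a.2.unpair.2 :=
    Computable.snd.comp (Computable.unpair.comp Computable.snd)
  have he : Computable fun a : ℕ × ℕ => a.1 := Computable.fst
  refine Primrec.and.to_comp.comp
    (hle.comp (Primrec.nat_mul.to_comp.comp (Computable.const 2) he) hx)
    (Primrec.and.to_comp.comp (comp_wb he ht hx) (Primrec.and.to_comp.comp
      (Primrec.not.to_comp.comp (comp_wb he ?_ hx)) (comp_cle.comp (hc.comp hx ht) he)))
  exact Primrec.nat_sub.to_comp.comp ht (Computable.const 1)

theorem comp_fst {c : ℕ → ℕ → ℚ} (hc : Computable₂ c) : Computable₂ (fst c) := by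
  have h1 : Computable₂ fun (a : ℕ × ℕ) (q : ℕ) => cand c a.1 q :=
    (comp_cand hc).comp (Computable.fst.comp Computable.fst) Computable.snd
  exact Primrec.and.to_comp.comp (comp_cand hc)
    (Primrec.not.to_comp.comp (comp_bex h1 Computable.snd))

theorem comp_en {c : ℕ → ℕ → ℚ} (hc : Computable₂ c) : Computable₂ (en c) := by
  have h1 : Computable₂ fun (a : (ℕ × ℕ) × ℕ) (t : ℕ) => fst c a.2 (Nat.pair t a.1.2) :=
    (comp_fst hc).comp (Computable.snd.comp Computable.fst)
      (Primrec₂.natPair.to_comp.comp Computable.snd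
        (Computable.snd.comp (Computable.fst.comp Computable.fst)))
  have h2 : Computable₂ fun (a : ℕ × ℕ) (e : ℕ) =>
      bex (fun t => fst c e (Nat.pair t a.2)) (a.1 + 1) :=
    comp_bex h1 (Computable.succ.comp (Computable.fst.comp Computable.fst))
  exact comp_bex h2 (Computable.succ.comp Computable.snd)

theorem fst_iff (c : ℕ → ℕ → ℚ) (e p : ℕ) :
    fst c e p = true ↔ cand c e p = true ∧ ∀ q < p, cand c e q ≠ true := by
  unfold fst
  rw [Bool.and_eq_true, Bool.not_eq_true', ← Bool.not_eq_true, bex_iff]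
  push Not
  rfl

theorem fst_uniq {c : ℕ → ℕ → ℚ} {e p q : ℕ} (hp : fst c e p = true) (hq : fst c e q = true) :
    p = q := by
  rw [fst_iff] at hp hq
  rcases lt_trichotomy p q with h | h | h
  · exact absurd hp.1 (hq.2 _ h)
  · exact h
  · exact absurd hq.1 (hp.2 _ h)

theorem cand_iff {c : ℕ → ℕ → ℚ} (h0 : ∀ x s, 0 ≤ c x s) (e t x : ℕ) :
    cand c e (Nat.pair t x) = true ↔
      2 * e ≤ x ∧ WAt e t x ∧ ¬ WAt e (t - 1) x ∧ c x t ≤ (1 / 2) ^ e := by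
  unfold cand
  simp only [Nat.unpair_pair, Bool.and_eq_true, decide_eq_true_eq, Bool.not_eq_true',
    cle_iff _ _ (h0 x t)]
  simp only [WAt, wb, Bool.not_eq_true]

theorem en_iff {c : ℕ → ℕ → ℚ} (h0 : ∀ x s, 0 ≤ c x s) (s x : ℕ) :
    en c s x = true ↔ ∃ e, ∃ t ≤ s, fst c e (Nat.pair t x) = true := by
  unfold en
  simp only [bex_iff]
  constructor
  · rintro ⟨e, _, t, ht, h⟩
    exact ⟨e, t, by omega, h⟩
  · rintro ⟨e, t, ht, h⟩
    have := ((cand_iff h0 e t x).1 ((fst_iff c e _).1 h).1).1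
    exact ⟨e, by omega, t, by omega, h⟩

theorem en_mono {c : ℕ → ℕ → ℚ} (h0 : ∀ x s, 0 ≤ c x s) {s t x : ℕ} (hst : s ≤ t)
    (h : en c s x = true) : en c t x = true := by
  rw [en_iff h0] at h ⊢
  obtain ⟨e, u, hu, h⟩ := h
  exact ⟨e, u, hu.trans hst, h⟩

theorem cost_le {c : ℕ → ℕ → ℚ} (h0 : ∀ x s, 0 ≤ c x s) (s : ℕ)
    (hs : stageCost c (en c) s ≠ 0) :
    ∃ e x, fst c e (Nat.pair s x) = true ∧ stageCost c (en c) s ≤ (1 / 2) ^ e := by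
  classical
  unfold stageCost at hs ⊢
  by_cases h1 : s = 0
  · simp [h1] at hs
  rw [if_neg h1] at hs ⊢
  by_cases h2 : ∃ x, en c s x ≠ en c (s - 1) x
  swap
  · rw [dif_neg h2] at hs; exact absurd rfl hs
  rw [dif_pos h2]
  have h3 := Nat.find_spec h2
  set x := Nat.find h2 with hx
  have hold : ¬ en c (s - 1) x = true := by
    intro h
    exact h3 ((en_mono h0 (Nat.sub_le s 1) h).trans h.symm)
  have hnew : en c s x = true := by
    by_contra h
    rw [Bool.not_eq_true] at h hold
    exact h3 (h.trans hold.symm)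
  obtain ⟨e, t, ht, hf⟩ := (en_iff h0 s x).1 hnew
  have hts : t = s := by
    by_contra hne
    exact hold ((en_iff h0 _ x).2 ⟨e, t, by omega, hf⟩)
  subst hts
  exact ⟨e, x, hf, ((cand_iff h0 e t x).1 ((fst_iff c e _).1 hf).1).2.2.2⟩

theorem total_cost {c : ℕ → ℕ → ℚ} (h0 : ∀ x s, 0 ≤ c x s) (F : Finset ℕ) :
    ∑ s ∈ F, stageCost c (en c) s ≤ 2 := by
  classical
  choose! e x he hcost using fun s => cost_le h0 (c := c) s
  set G := F.filter fun s => stageCost c (en c) s ≠ 0 with hG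
  have hinj : Set.InjOn e (G : Set ℕ) := by
    intro s hs t ht hst
    have h1 := he s (Finset.mem_filter.1 hs).2
    have h2 := he t (Finset.mem_filter.1 ht).2
    rw [hst] at h1
    exact (Nat.pair_eq_pair.1 (fst_uniq h1 h2)).1
  have geo : ∀ n : ℕ, ∑ i ∈ Finset.range n, ((1 : ℚ) / 2) ^ i ≤ 2 := by
    intro n
    have : ∑ i ∈ Finset.range n, ((1 : ℚ) / 2) ^ i = 2 - 2 * (1 / 2) ^ n := by
      induction n with
      | zero => simp
      | succ n ih => rw [Finset.sum_range_succ, ih]; ring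
    rw [this]
    have : (0 : ℚ) ≤ (1 / 2) ^ n := by positivity
    linarith
  calc ∑ s ∈ F, stageCost c (en c) s = ∑ s ∈ G, stageCost c (en c) s :=
        (Finset.sum_filter_ne_zero F).symm
    _ ≤ ∑ s ∈ G, ((1 : ℚ) / 2) ^ e s :=
        Finset.sum_le_sum fun s hs => hcost s (Finset.mem_filter.1 hs).2
    _ = ∑ i ∈ G.image e, ((1 : ℚ) / 2) ^ i := (Finset.sum_image hinj).symm
    _ ≤ ∑ i ∈ Finset.range ((G.image e).sup id + 1), ((1 : ℚ) / 2) ^ i := by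
        refine Finset.sum_le_sum_of_subset_of_nonneg ?_ fun i _ _ => by positivity
        intro i hi
        rw [Finset.mem_range]
        exact Nat.lt_succ_of_le (Finset.le_sup (f := id) hi)
    _ ≤ 2 := geo _

theorem met {c : ℕ → ℕ → ℚ} (h0 : ∀ x s, 0 ≤ c x s) (hlim : LimitCondition c) (e : ℕ)
    (he : (Wset e).Infinite) :
    ∃ s x, 1 ≤ s ∧ WAt e s x ∧ ¬ WAt e (s - 1) x ∧ en c s x = true := by
  classical
  have hbd : ∀ s x, WAt e s x → x < s := by
    intro s x h
    obtain ⟨v, hv⟩ := Option.isSome_iff_exists.1 h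
    exact Nat.Partrec.Code.evaln_bound hv
  have hex : ∃ p, cand c e p = true := by
    obtain ⟨x0, hx0⟩ := hlim ((1 / 2) ^ e) (by positivity)
    obtain ⟨x, hx, hxl⟩ := he.exists_gt (max x0 (2 * e))
    have hst : ∃ s, WAt e s x := by
      obtain ⟨v, hv⟩ := Part.dom_iff_mem.1 hx
      obtain ⟨k, hk⟩ := Nat.Partrec.Code.evaln_complete.1 hv
      exact ⟨k, Option.isSome_iff_exists.2 ⟨v, hk⟩⟩
    have hs := Nat.find_spec hst
    have hlt := hbd _ _ hs
    refine ⟨Nat.pair (Nat.find hst) x, (cand_iff h0 e _ x).2 ⟨?_, hs, ?_, ?_⟩⟩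
    · have := le_max_right x0 (2 * e); omega
    · exact Nat.find_min hst (by omega)
    · exact hx0 x ((le_max_left _ _).trans hxl.le) _
  have hp := Nat.find_spec hex
  have hmin : ∀ q < Nat.find hex, cand c e q ≠ true := fun q hq => Nat.find_min hex hq
  generalize Nat.find hex = p at hp hmin
  obtain ⟨⟨t, x⟩, rfl⟩ : ∃ p' : ℕ × ℕ, p = Nat.pair p'.1 p'.2 := ⟨p.unpair, by simp⟩
  obtain ⟨_, h1, h2, _⟩ := (cand_iff h0 e t x).1 hp
  have := hbd _ _ h1
  exact ⟨t, x, by omega, h1, h2, (en_iff h0 t x).2 ⟨e, t, le_rfl, (fst_iff c e _).2 ⟨hp, hmin⟩⟩⟩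

theorem coinf {c : ℕ → ℕ → ℚ} (h0 : ∀ x s, 0 ≤ c x s) (A : ℕ → Bool)
    (hA : ∀ x, A x = true ↔ ∃ s, en c s x = true) : {x | A x = false}.Infinite := by
  classical
  intro hfin
  have hA' : ∀ x, A x = true → ∃ e t, fst c e (Nat.pair t x) = true ∧ 2 * e ≤ x := by
    intro x hx
    obtain ⟨s, hs⟩ := (hA x).1 hx
    obtain ⟨e, t, _, hf⟩ := (en_iff h0 s x).1 hs
    exact ⟨e, t, hf, ((cand_iff h0 e t x).1 ((fst_iff c e _).1 hf).1).1⟩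
  choose! e t hf hle using hA'
  set n := hfin.toFinset.card + 1 with hn
  have h1 : ((Finset.range (2 * n)).filter fun x => A x = true).card ≤ (Finset.range n).card := by
    refine Finset.card_le_card_of_injOn e ?_ ?_
    · intro x hx
      have hx' := Finset.mem_filter.1 hx
      have h2 := hle x hx'.2
      have h3 := Finset.mem_range.1 hx'.1
      exact Finset.mem_coe.2 (Finset.mem_range.2 (by omega))
    · intro x hx y hy hxy
      have h2 := hf x (Finset.mem_filter.1 hx).2
      have h3 := hf y (Finset.mem_filter.1 hy).2
      rw [hxy] at h2
      exact (Nat.pair_eq_pair.1 (fst_uniq h2 h3)).2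
  have h2 : ((Finset.range (2 * n)).filter fun x => ¬ A x = true).card ≤ hfin.toFinset.card := by
    refine Finset.card_le_card fun x hx => ?_
    rw [Set.Finite.mem_toFinset]
    exact eq_false_of_ne_true (Finset.mem_filter.1 hx).2
  have h3 := Finset.card_filter_add_card_filter_not (s := Finset.range (2 * n))
    (fun x => A x = true)
  rw [Finset.card_range] at h1 h3
  omega

theorem ce {c : ℕ → ℕ → ℚ} (hc : Computable₂ c) (A : ℕ → Bool)
    (hA : ∀ x, A x = true ↔ ∃ s, en c s x = true) : CE A := by
  have h : Computable₂ fun x s => en c s x := (comp_en hc).comp Computable.snd Computable.fst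
  refine ⟨fun x => Nat.rfind (pf fun s => en c s x),
    Partrec.nat_iff.1 (Partrec.rfind h.partrec₂), fun x => ?_⟩
  rw [hA]
  refine Iff.trans ?_ Nat.rfind_dom.symm
  constructor
  · rintro ⟨s, hs⟩
    exact ⟨s, by simp [pf, hs], fun _ => trivial⟩
  · rintro ⟨s, hs, _⟩
    exact ⟨s, (Part.mem_some_iff.1 hs).symm⟩

end PSaux

/-- Every cost function with the limit condition is obeyed by a
promptly simple set. -/
theorem promptly_simple_obeys (c : ℕ → ℕ → ℚ) (hc : CostFunction c)
    (hlim : LimitCondition c) :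
    ∃ A : ℕ → Bool, PromptlySimple A ∧ Obeys A c := by
  classical
  obtain ⟨h1, h0, _, _⟩ := hc
  have hA : ∀ x, (decide (∃ s, PSaux.en c s x = true) : Bool) = true ↔
      ∃ s, PSaux.en c s x = true := fun x => decide_eq_true_iff
  refine ⟨fun x => decide (∃ s, PSaux.en c s x = true),
    ⟨PSaux.ce h1 _ hA, PSaux.coinf h0 _ hA, PSaux.en c, PSaux.comp_en h1,
      fun s x h => PSaux.en_mono h0 (Nat.le_succ s) h, hA, PSaux.met h0 hlim⟩,
    PSaux.en c, ⟨PSaux.comp_en h1, fun x => ?_⟩, 2, PSaux.total_cost h0⟩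
  by_cases h : ∃ s, PSaux.en c s x = true
  · obtain ⟨t, ht⟩ := id h
    exact ⟨t, fun s hs => (PSaux.en_mono h0 hs ht).trans (decide_eq_true h).symm⟩
  · refine ⟨0, fun s _ => ?_⟩
    have h' : ¬ PSaux.en c s x = true := fun hh => h ⟨s, hh⟩
    exact (eq_false_of_ne_true h').trans (decide_eq_false h).symm
end
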